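/- Under the null hypothesis θ_1 = θ_2 and Assumptions (A1)–(A3), the coordinatewise pairwise-difference quantile scale estimators satisfy max_{k=1,2} max_{1≤j≤p} | d̂_{kj}/d_{kj} − 1 | = O_p(r_D), where r_D = (x_N/n_0)^{1/2}, x_N = log(8pN), N = n_1+n_2, n_0 = min(n_1,n_2); that is, for every ε>0 there exists M<∞ with limsup P( max_{k,j} | d̂_{kj}/d_{kj} − 1 | > M r_D ) < ε. -/

import Mathlib

open MeasureTheory ProbabilityTheory Matrix Filter

noncomputable section

namespace PDQ

/-- Euclidean norm of a vector in `ℝ^p`. -/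
def enorm {p : ℕ} (v : Fin p → ℝ) : ℝ := Real.sqrt (∑ j, v j ^ 2)

/-- The spatial sign `U(x) = x/‖x‖` (`U(0) = 0`). -/
def sgn {p : ℕ} (v : Fin p → ℝ) : Fin p → ℝ := (enorm v)⁻¹ • v

/-- Operator (spectral) norm of a real matrix. -/
def opNorm {p q : ℕ} (A : Matrix (Fin p) (Fin q) ℝ) : ℝ :=
  sSup ((fun v => enorm (A.mulVec v)) '' {v : Fin q → ℝ | enorm v ≤ 1})

/-- Symmetrization `sym(A) = (A + Aᵀ)/2`. -/
def symPart {p : ℕ} (A : Matrix (Fin p) (Fin p) ℝ) : Matrix (Fin p) (Fin p) ℝ :=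
  (2 : ℝ)⁻¹ • (A + Aᵀ)

/-- The two-sample elliptical model
`X_{ki} = θ_k + (D_k°)^{1/2} R_k^{1/2} ξ_{ki} u_{ki}`, `k = 0, 1` (samples 1 and 2),
with i.i.d. observations within each sample, mutual independence of all the pairs
`(ξ_{ki}, u_{ki})`, `u_{ki}` uniform on the unit sphere `S^{p−1}` (characterized by unit
norm and rotation invariance of its law) independent of the positive radial
variable `ξ_{ki}`, `D_k°` a positive diagonal matrix, and `R_k` a positive definite
correlation matrix given through a square root `Rhalf k`. -/
structure Model (Ω : Type) [MeasurableSpace Ω] where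
  p : ℕ
  hp : 0 < p
  n : Fin 2 → ℕ
  hn : ∀ k, 2 ≤ n k
  μ : Measure Ω
  hμ : IsProbabilityMeasure μ
  θ : Fin 2 → Fin p → ℝ
  d0 : Fin 2 → Fin p → ℝ
  hd0 : ∀ k j, 0 < d0 k j
  Rhalf : Fin 2 → Matrix (Fin p) (Fin p) ℝ
  hRdiag : ∀ k j, (Rhalf k * (Rhalf k)ᵀ) j j = 1
  hRpd : ∀ k, (Rhalf k * (Rhalf k)ᵀ).PosDef
  ξ : (k : Fin 2) → Fin (n k) → Ω → ℝ
  u : (k : Fin 2) → Fin (n k) → Ω → Fin p → ℝ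
  hmξ : ∀ k i, Measurable (ξ k i)
  hmu : ∀ k i, Measurable (u k i)
  hξpos : ∀ k i, ∀ᵐ ω ∂μ, 0 < ξ k i ω
  hunit : ∀ k i, ∀ᵐ ω ∂μ, ∑ j, u k i ω j ^ 2 = 1
  hrot : ∀ k i (Q : Matrix (Fin p) (Fin p) ℝ), Q * Qᵀ = 1 →
    μ.map (fun ω => Q.mulVec (u k i ω)) = μ.map (u k i)
  hξu : ∀ k i, IndepFun (ξ k i) (u k i) μ
  hindep : iIndepFun
    (fun ki : (k : Fin 2) × Fin (n k) => fun ω => (ξ ki.1 ki.2 ω, u ki.1 ki.2 ω)) μ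
  hident : ∀ k i i', IdentDistrib (fun ω => (ξ k i ω, u k i ω))
    (fun ω => (ξ k i' ω, u k i' ω)) μ μ

namespace Model

variable {Ω : Type} [MeasurableSpace Ω] (M : Model Ω)

/-- The null hypothesis `θ_1 = θ_2`. -/
def H0 : Prop := M.θ 0 = M.θ 1

/-- First observation index in sample `k`. -/
def o0 (k : Fin 2) : Fin (M.n k) := ⟨0, lt_of_lt_of_le (by norm_num) (M.hn k)⟩

/-- Second observation index in sample `k`. -/
def o1 (k : Fin 2) : Fin (M.n k) := ⟨1, lt_of_lt_of_le (by norm_num) (M.hn k)⟩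

/-- First coordinate index. -/
def j0 : Fin M.p := ⟨0, M.hp⟩

/-- The observations: `X_{ki} = θ_k + (D_k°)^{1/2} R_k^{1/2} (ξ_{ki} u_{ki})`. -/
def X (k : Fin 2) (i : Fin (M.n k)) (ω : Ω) : Fin M.p → ℝ := fun j =>
  M.θ k j + Real.sqrt (M.d0 k j) * (M.Rhalf k).mulVec (fun m => M.ξ k i ω * M.u k i ω m) j

/-- `Z_{ki} = ξ_{ki} e₁ᵀ u_{ki}`. -/
def Z (k : Fin 2) (i : Fin (M.n k)) (ω : Ω) : ℝ := M.ξ k i ω * M.u k i ω M.j0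

/-- `F_{k,Δ}(t) = P(|Z_{k1} − Z_{k2}| ≤ t)` for independent copies of `ξ e₁ᵀu`. -/
def Fdelta (k : Fin 2) (t : ℝ) : ℝ :=
  (M.μ {ω | |M.Z k (M.o0 k) ω - M.Z k (M.o1 k) ω| ≤ t}).toReal

/-- The population `α`-quantile `q_{k,α} = F_{k,Δ}^{−1}(α)`. -/
def qA (α : ℝ) (k : Fin 2) : ℝ := sInf {t : ℝ | 0 ≤ t ∧ α ≤ M.Fdelta k t}

/-- The diagonal target `d_{kj} = q_{k,α}² d°_{kj}`. -/
def dT (α : ℝ) (k : Fin 2) (j : Fin M.p) : ℝ := (M.qA α k) ^ 2 * M.d0 k j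

/-- Empirical pairwise-difference CDF `F̂_{kj}`. -/
def Fhat (k : Fin 2) (j : Fin M.p) (t : ℝ) (ω : Ω) : ℝ :=
  ((M.n k).choose 2 : ℝ)⁻¹ *
    ∑ i : Fin (M.n k), ∑ l : Fin (M.n k),
      if i < l then (if |M.X k i ω j - M.X k l ω j| ≤ t then (1 : ℝ) else 0) else 0

/-- The pairwise-difference quantile estimator `q̂_{kj,α}`. -/
def qhat (α : ℝ) (k : Fin 2) (j : Fin M.p) (ω : Ω) : ℝ :=
  sInf {t : ℝ | 0 ≤ t ∧ α ≤ M.Fhat k j t ω}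

/-- The diagonal scale estimator `d̂_{kj} = q̂_{kj,α}²`. -/
def dhat (α : ℝ) (k : Fin 2) (j : Fin M.p) (ω : Ω) : ℝ := (M.qhat α k j ω) ^ 2

/-- `N = n₁ + n₂`. -/
def NN : ℕ := M.n 0 + M.n 1

/-- `n₀ = min(n₁, n₂)`. -/
def n0 : ℕ := min (M.n 0) (M.n 1)

/-- `x_N = log(8 p N)`. -/
def xN : ℝ := Real.log (8 * M.p * M.NN)

/-- `r_D = (x_N / n₀)^{1/2}`. -/
def rD : ℝ := Real.sqrt (M.xN / M.n0)

end Model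

/-- Assumption (A1): `n₁/N → κ ∈ (0,1)` and `x_N/n₀ → 0`. -/
def A1 {Ω : Type} [MeasurableSpace Ω] (Ms : ℕ → Model Ω) : Prop :=
  (∃ κ : ℝ, 0 < κ ∧ κ < 1 ∧
    Tendsto (fun ν => ((Ms ν).n 0 : ℝ) / ((Ms ν).NN : ℝ)) atTop (nhds κ)) ∧
  Tendsto (fun ν => (Ms ν).xN / ((Ms ν).n0 : ℝ)) atTop (nhds 0)

/-- Assumption (A2): uniformly bounded positive diagonal entries
(the i.i.d. elliptical sampling scheme is part of `Model`). -/
def A2 {Ω : Type} [MeasurableSpace Ω] (Ms : ℕ → Model Ω) : Prop :=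
  ∃ dlo dhi : ℝ, 0 < dlo ∧
    ∀ ν k j, dlo ≤ (Ms ν).d0 k j ∧ (Ms ν).d0 k j ≤ dhi

/-- Assumption (A3): quantile regularity, uniformly along the sequence. -/
def A3 {Ω : Type} [MeasurableSpace Ω] (α : ℝ) (Ms : ℕ → Model Ω) : Prop :=
  ∃ qlo qhi cF CF εF : ℝ, 0 < qlo ∧ qlo < qhi ∧ 0 < cF ∧ 0 < εF ∧
    ∀ ν k, (qlo ≤ (Ms ν).qA α k ∧ (Ms ν).qA α k ≤ qhi) ∧
      ∀ t : ℝ, |t - (Ms ν).qA α k| ≤ εF →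
        cF * |t - (Ms ν).qA α k| ≤ |(Ms ν).Fdelta k t - α| ∧
        |(Ms ν).Fdelta k t - α| ≤ CF * |t - (Ms ν).qA α k|

end PDQ

theorem Equiv.Perm.sum_apply_apply_eq {ι : Type*} [Fintype ι] [DecidableEq ι]
    (f : ι → ι → ℝ) {a b c d : ι} (hab : a ≠ b) (hcd : c ≠ d) :
    ∑ σ : Equiv.Perm ι, f (σ a) (σ b) = ∑ σ : Equiv.Perm ι, f (σ c) (σ d) := by
  have h2 : MulAction.IsMultiplyPretransitive (Equiv.Perm ι) ι 2 :=
    Equiv.Perm.isMultiplyPretransitive ι 2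
  obtain ⟨τ, hτc, hτd⟩ := MulAction.is_two_pretransitive_iff.mp h2 hcd hab
  rw [Equiv.Perm.smul_def] at hτc hτd
  rw [← Equiv.sum_comp (Equiv.mulRight τ) (fun σ : Equiv.Perm ι => f (σ c) (σ d))]
  simp [hτc, hτd]

theorem sum_sum_ite_ne_eq_two_mul {n : ℕ} (f : Fin n → Fin n → ℝ) (hf : ∀ i l, f i l = f l i) :
    ∑ i, ∑ l, (if i ≠ l then f i l else 0) = 2 * ∑ i, ∑ l, (if i < l then f i l else 0) := by
  have hsplit : ∀ i l : Fin n, (if i ≠ l then f i l else 0)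
      = (if i < l then f i l else 0) + (if l < i then f l i else 0) := by
    intro i l
    rcases lt_trichotomy i l with h | h | h
    · simp [h, h.ne, h.not_gt]
    · simp [h]
    · simp [h, h.ne', h.not_gt, hf i l]
  simp_rw [hsplit, Finset.sum_add_distrib]
  rw [Finset.sum_comm (f := fun i l => if l < i then f l i else 0)]
  ring

theorem pair_average_eq_perm_average {n : ℕ} (hn : 2 ≤ n) (f : Fin n → Fin n → ℝ)
    (hf : ∀ i l, f i l = f l i) {a b : Fin n} (hab : a ≠ b) :
    (n.choose 2 : ℝ)⁻¹ * ∑ i, ∑ l, (if i < l then f i l else 0)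
      = (n.factorial : ℝ)⁻¹ * ∑ σ : Equiv.Perm (Fin n), f (σ a) (σ b) := by
  have hreindex : ∀ σ : Equiv.Perm (Fin n),
      ∑ c, ∑ d, (if c ≠ d then f (σ c) (σ d) else 0)
        = ∑ i, ∑ l, (if i ≠ l then f i l else 0) := by
    intro σ
    rw [← Equiv.sum_comp σ (fun i => ∑ l, (if i ≠ l then f i l else 0))]
    refine Finset.sum_congr rfl fun c _ => ?_
    rw [← Equiv.sum_comp σ (fun l => (if σ c ≠ l then f (σ c) l else 0))]
    simp [σ.injective.eq_iff]
  have hconst : ∀ c d : Fin n,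
      ∑ σ : Equiv.Perm (Fin n), (if c ≠ d then f (σ c) (σ d) else 0)
        = if c ≠ d then ∑ σ : Equiv.Perm (Fin n), f (σ a) (σ b) else 0 := by
    intro c d
    by_cases hcd : c = d
    · simp [hcd]
    · simp [hcd, Equiv.Perm.sum_apply_apply_eq f hab hcd]
  have hcount : ∑ c : Fin n, ∑ d : Fin n,
      (if c ≠ d then ∑ σ : Equiv.Perm (Fin n), f (σ a) (σ b) else 0)
        = (n * (n - 1) : ℝ) * ∑ σ : Equiv.Perm (Fin n), f (σ a) (σ b) := by
    have : ∀ c : Fin n, (Finset.univ.filter fun d => c ≠ d).card = n - 1 := by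
      intro c
      rw [Finset.filter_ne, Finset.card_erase_of_mem (Finset.mem_univ c), Finset.card_fin]
    simp only [← Finset.sum_filter, Finset.sum_const, this, nsmul_eq_mul, Finset.card_univ,
      Fintype.card_fin]
    push_cast [Nat.cast_sub (show 1 ≤ n by omega)]
    ring
  have hdouble : (n * (n - 1) : ℝ) * ∑ σ : Equiv.Perm (Fin n), f (σ a) (σ b)
      = n.factorial * (2 * ∑ i, ∑ l, (if i < l then f i l else 0)) := by
    rw [← hcount, ← sum_sum_ite_ne_eq_two_mul f hf]
    simp_rw [← hconst]
    have hswap : ∑ c, ∑ d, ∑ σ : Equiv.Perm (Fin n), (if c ≠ d then f (σ c) (σ d) else 0)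
        = ∑ σ : Equiv.Perm (Fin n), ∑ c, ∑ d, (if c ≠ d then f (σ c) (σ d) else 0) := by
      rw [Finset.sum_comm]
      simp_rw [Finset.sum_comm (s := Finset.univ (α := Fin n))
        (t := Finset.univ (α := Equiv.Perm (Fin n)))]
      exact Finset.sum_congr rfl fun σ _ => Finset.sum_comm
    rw [hswap]
    simp_rw [hreindex]
    simp [Fintype.card_perm]
  have hn' : (2 : ℝ) ≤ n := by exact_mod_cast hn
  have hfac : (n.factorial : ℝ) ≠ 0 := by positivity
  rw [Nat.cast_choose_two]
  have h0 : (n : ℝ) ≠ 0 := by positivity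
  have h1 : (n : ℝ) - 1 ≠ 0 := by linarith
  field_simp
  linarith

theorem ProbabilityTheory.HasSubgaussianMGF.average {Ω ι : Type*} [MeasurableSpace Ω]
    [Fintype ι] [Nonempty ι] {μ : Measure Ω} {c : NNReal} {W : ι → Ω → ℝ}
    (hW : ∀ i, HasSubgaussianMGF (W i) c μ) :
    HasSubgaussianMGF (fun ω => (Fintype.card ι : ℝ)⁻¹ * ∑ i, W i ω) c μ := by
  have hcard : (0 : ℝ) < Fintype.card ι := by exact_mod_cast Fintype.card_pos
  have hle : ∀ t ω, Real.exp (t * ((Fintype.card ι : ℝ)⁻¹ * ∑ i, W i ω))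
      ≤ (Fintype.card ι : ℝ)⁻¹ * ∑ i, Real.exp (t * W i ω) := by
    intro t ω
    have h := convexOn_exp.map_sum_le (t := Finset.univ) (w := fun _ : ι => (Fintype.card ι : ℝ)⁻¹)
      (p := fun i => t * W i ω) (fun _ _ => by positivity) (by simp [hcard.ne'])
      (fun _ _ => Set.mem_univ _)
    simp only [smul_eq_mul, ← Finset.mul_sum] at h
    rwa [mul_left_comm] at h
  have hint : ∀ t, Integrable
      (fun ω => (Fintype.card ι : ℝ)⁻¹ * ∑ i, Real.exp (t * W i ω)) μ := fun t =>
    (integrable_finsetSum _ fun i _ => (hW i).integrable_exp_mul t).const_mul _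
  have hmeas : AEMeasurable (fun ω => (Fintype.card ι : ℝ)⁻¹ * ∑ i, W i ω) μ :=
    (Finset.aemeasurable_fun_sum _ fun i _ => (hW i).aemeasurable).const_mul _
  have hint' : ∀ t, Integrable
      (fun ω => Real.exp (t * ((Fintype.card ι : ℝ)⁻¹ * ∑ i, W i ω))) μ := fun t => by
    refine (hint t).mono' (hmeas.const_mul t).exp.aestronglyMeasurable (ae_of_all _ fun ω => ?_)
    rw [Real.norm_eq_abs, Real.abs_exp]
    exact hle t ω
  refine ⟨hint', fun t => ?_⟩
  calc mgf (fun ω => (Fintype.card ι : ℝ)⁻¹ * ∑ i, W i ω) μ t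
      ≤ ∫ ω, (Fintype.card ι : ℝ)⁻¹ * ∑ i, Real.exp (t * W i ω) ∂μ :=
        integral_mono (hint' t) (hint t) (hle t)
    _ = (Fintype.card ι : ℝ)⁻¹ * ∑ i, mgf (W i) μ t := by
        rw [integral_const_mul, integral_finsetSum _ fun i _ => (hW i).integrable_exp_mul t]
        rfl
    _ ≤ (Fintype.card ι : ℝ)⁻¹ * ∑ _i : ι, Real.exp (c * t ^ 2 / 2) := by
        gcongr with i
        exact (hW i).mgf_le t
    _ = Real.exp (c * t ^ 2 / 2) := by
        simp [hcard.ne']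

theorem ProbabilityTheory.iIndepFun.hasSubgaussianMGF_sum_pairs {Ω ι κ : Type*} [MeasurableSpace Ω]
    {μ : Measure Ω} [IsProbabilityMeasure μ] {Y : ι → Ω → ℝ}
    (hY : ∀ i, Measurable (Y i)) (hind : iIndepFun Y μ) {H : ℝ × ℝ → ℝ} (hH : Measurable H)
    (hH01 : ∀ z, H z ∈ Set.Icc (0 : ℝ) 1) {F : ℝ}
    {a b : κ → ι} (ha : Function.Injective a) (hb : Function.Injective b)
    (hab : ∀ i l, a i ≠ b l) (hF : ∀ i, ∫ ω, H (Y (a i) ω, Y (b i) ω) ∂μ = F) (s : Finset κ) :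
    HasSubgaussianMGF (fun ω => ∑ i ∈ s, (H (Y (a i) ω, Y (b i) ω) - F)) (s.card * 4⁻¹) μ := by
  classical
  induction s using Finset.induction_on with
  | empty => simp
  | insert i s his ih =>
    have hone : HasSubgaussianMGF (fun ω => H (Y (a i) ω, Y (b i) ω) - F) 4⁻¹ μ := by
      have h := hasSubgaussianMGF_of_mem_Icc (μ := μ) (a := 0) (b := 1)
        (X := fun ω => H (Y (a i) ω, Y (b i) ω))
        (hH.comp ((hY _).prodMk (hY _))).aemeasurable (ae_of_all _ fun ω => hH01 _)
      rw [hF i] at h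
      convert h using 1
      ext
      norm_num
    let S : Finset ι := s.image a ∪ s.image b
    let T : Finset ι := {a i, b i}
    have hST : Disjoint S T := by
      rw [Finset.disjoint_left]
      intro x hx hxT
      simp only [S, T, Finset.mem_union, Finset.mem_image, Finset.mem_insert,
        Finset.mem_singleton] at hx hxT
      rcases hx with ⟨l, hl, rfl⟩ | ⟨l, hl, rfl⟩ <;> rcases hxT with h | h
      · exact his (ha h ▸ hl)
      · exact hab _ _ h
      · exact hab _ _ h.symm
      · exact his (hb h ▸ hl)
    let extend : (S → ℝ) → ι → ℝ := fun y l => if h : l ∈ S then y ⟨l, h⟩ else 0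
    have hextend : ∀ l, Measurable fun y => extend y l := by
      intro l
      by_cases h : l ∈ S
      · simpa [extend, h] using measurable_pi_apply _
      · simp [extend, h]
    have hpast := (hind.indepFun_finset S T hST hY).comp
      (φ := fun y => ∑ l ∈ s, (H (extend y (a l), extend y (b l)) - F))
      (ψ := fun y : T → ℝ => H (y ⟨a i, by simp [T]⟩, y ⟨b i, by simp [T]⟩) - F)
      (Finset.measurable_fun_sum _ fun l _ =>
        (hH.comp ((hextend _).prodMk (hextend _))).sub_const _)
      ((hH.comp ((measurable_pi_apply _).prodMk (measurable_pi_apply _))).sub_const _)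
    have hsum : ((fun y => ∑ l ∈ s, (H (extend y (a l), extend y (b l)) - F)) ∘
        fun ω (l : S) => Y l ω) = fun ω => ∑ l ∈ s, (H (Y (a l) ω, Y (b l) ω) - F) := by
      funext ω
      refine Finset.sum_congr rfl fun l hl => ?_
      have h1 : a l ∈ S := Finset.mem_union_left _ (Finset.mem_image_of_mem a hl)
      have h2 : b l ∈ S := Finset.mem_union_right _ (Finset.mem_image_of_mem b hl)
      simp [extend, h1, h2]
    rw [hsum] at hpast
    have hadd := hone.add_of_indepFun ih hpast.symm
    simp_rw [Finset.sum_insert his, Finset.card_insert_of_notMem his]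
    convert hadd using 1
    push_cast
    ring

/-- Hoeffding's bound for U-statistics of order two with a symmetric kernel valued in `[0, 1]`. -/
theorem ProbabilityTheory.iIndepFun.hasSubgaussianMGF_pair_average {Ω : Type*} [MeasurableSpace Ω]
    {μ : Measure Ω} [IsProbabilityMeasure μ] {n : ℕ} (hn : 2 ≤ n) {Y : Fin n → Ω → ℝ}
    (hY : ∀ i, Measurable (Y i)) (hind : iIndepFun Y μ) {H : ℝ × ℝ → ℝ} (hH : Measurable H)
    (hH01 : ∀ z, H z ∈ Set.Icc (0 : ℝ) 1) (hsymm : ∀ x y, H (x, y) = H (y, x)) {F : ℝ}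
    (hF : ∀ i l, i ≠ l → ∫ ω, H (Y i ω, Y l ω) ∂μ = F) :
    HasSubgaussianMGF (fun ω => (n.choose 2 : ℝ)⁻¹ *
      (∑ i, ∑ l, if i < l then H (Y i ω, Y l ω) else 0) - F) (4 * (n / 2 : ℕ))⁻¹ μ := by
  have hm : 0 < n / 2 := by omega
  let a : Fin (n / 2) → Fin n := fun i => ⟨2 * i, by omega⟩
  let b : Fin (n / 2) → Fin n := fun i => ⟨2 * i + 1, by omega⟩
  have ha : Function.Injective a := fun i l h => by
    simp only [a, Fin.mk.injEq] at h
    omega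
  have hb : Function.Injective b := fun i l h => by
    simp only [b, Fin.mk.injEq] at h
    omega
  have hab : ∀ i l, a i ≠ b l := fun i l h => by
    simp only [a, b, Fin.mk.injEq] at h
    omega
  have hblock : ∀ σ : Equiv.Perm (Fin n), HasSubgaussianMGF (fun ω => ((n / 2 : ℕ) : ℝ)⁻¹ *
      ∑ i, (H (Y (σ (a i)) ω, Y (σ (b i)) ω) - F)) (4 * (n / 2 : ℕ))⁻¹ μ := by
    intro σ
    have h := (hind.hasSubgaussianMGF_sum_pairs hY hH hH01 (σ.injective.comp ha)
      (σ.injective.comp hb) (fun i l h => hab i l (σ.injective h))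
      (fun i => hF _ _ fun h => hab i i (σ.injective h)) Finset.univ).const_mul
      ((n / 2 : ℕ) : ℝ)⁻¹
    simp only [Function.comp_apply] at h
    convert h using 1
    have : ((n / 2 : ℕ) : ℝ) ≠ 0 := by positivity
    rw [← NNReal.coe_inj, Finset.card_univ, Fintype.card_fin]
    change _ = (((n / 2 : ℕ) : ℝ)⁻¹) ^ 2 * (((n / 2 : ℕ) * 4⁻¹ : NNReal) : ℝ)
    push_cast
    field_simp
  have havg := HasSubgaussianMGF.average hblock
  convert havg using 1
  funext ω
  have hper : ∀ i : Fin (n / 2), ∑ σ : Equiv.Perm (Fin n), H (Y (σ (a i)) ω, Y (σ (b i)) ω)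
      = n.factorial * ((n.choose 2 : ℝ)⁻¹ *
        ∑ i, ∑ l, if i < l then H (Y i ω, Y l ω) else 0) := by
    intro i
    rw [pair_average_eq_perm_average hn (fun i l => H (Y i ω, Y l ω)) (fun _ _ => hsymm _ _)
      (hab i i)]
    have : (n.factorial : ℝ) ≠ 0 := by positivity
    field_simp
  rw [← Finset.mul_sum, Finset.sum_comm (s := (Finset.univ : Finset (Equiv.Perm (Fin n))))]
  simp_rw [Finset.sum_sub_distrib, hper]
  simp only [Finset.sum_const, Finset.card_univ, Fintype.card_perm, Fintype.card_fin,
    nsmul_eq_mul]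
  have h1 : (n.factorial : ℝ) ≠ 0 := by positivity
  have h2 : ((n / 2 : ℕ) : ℝ) ≠ 0 := by positivity
  field_simp

theorem Matrix.exists_orthogonal_row_eq {p : ℕ} (j₀ : Fin p) (r : Fin p → ℝ)
    (hr : ∑ m, r m ^ 2 = 1) :
    ∃ Q : Matrix (Fin p) (Fin p) ℝ, Q * Qᵀ = 1 ∧ Q j₀ = r := by
  let v : Fin p → EuclideanSpace ℝ (Fin p) := fun _ => WithLp.toLp 2 r
  have hv : Orthonormal ℝ (({j₀} : Set (Fin p)).domRestrict v) := by
    refine ⟨fun i => ?_, fun i l hil => (hil (Subsingleton.elim i l)).elim⟩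
    simp [v, EuclideanSpace.norm_eq, hr]
  obtain ⟨b, hb⟩ := hv.exists_orthonormalBasis_extension_of_card_eq (by simp)
  refine ⟨Matrix.of fun i m => b i m, ?_, ?_⟩
  · ext i l
    have h := orthonormal_iff_ite.mp b.orthonormal l i
    simp only [PiLp.inner_apply, RCLike.inner_apply, conj_trivial] at h
    simp only [Matrix.mul_apply, Matrix.transpose_apply, Matrix.of_apply, Matrix.one_apply, h,
      eq_comm]
  · funext m
    simp [hb j₀ rfl, v]

namespace PDQ.Model

variable {Ω : Type} [MeasurableSpace Ω] (M : Model Ω)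

/-- The coordinate `j` of an observation of sample `k`, centred and divided by its scale. -/
def standardized (k : Fin 2) (j : Fin M.p) (i : Fin (M.n k)) (ω : Ω) : ℝ :=
  (M.Rhalf k).mulVec (fun m => M.ξ k i ω * M.u k i ω m) j

theorem standardized_eq (k : Fin 2) (j : Fin M.p) (i : Fin (M.n k)) (ω : Ω) :
    M.standardized k j i ω = M.ξ k i ω * ∑ m, M.Rhalf k j m * M.u k i ω m := by
  simp only [standardized, Matrix.mulVec, dotProduct, Finset.mul_sum]
  exact Finset.sum_congr rfl fun m _ => by ring

theorem measurable_standardized (k : Fin 2) (j : Fin M.p) (i : Fin (M.n k)) :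
    Measurable (M.standardized k j i) := by
  have hξ := M.hmξ k i
  have hu := M.hmu k i
  unfold standardized Matrix.mulVec dotProduct
  fun_prop

theorem iIndepFun_standardized (k : Fin 2) (j : Fin M.p) :
    iIndepFun (M.standardized k j) M.μ := by
  have h := (M.hindep.precomp (g := fun i : Fin (M.n k) => (⟨k, i⟩ : (k : Fin 2) × Fin (M.n k)))
    (sigma_mk_injective (β := fun k => Fin (M.n k)))).comp
    (fun _ z => z.1 * ∑ m, M.Rhalf k j m * z.2 m)
    (fun _ => by fun_prop)
  convert h using 2 with i
  funext ω
  exact M.standardized_eq k j i ω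

theorem identDistrib_standardized (k : Fin 2) (j : Fin M.p) (i l : Fin (M.n k)) :
    IdentDistrib (M.standardized k j i) (M.Z k l) M.μ M.μ := by
  have := M.hμ
  have hr : ∑ m, M.Rhalf k j m ^ 2 = 1 := by
    have h := M.hRdiag k j
    simp only [Matrix.mul_apply, Matrix.transpose_apply] at h
    simpa only [sq] using h
  obtain ⟨Q, hQ, hQrow⟩ := Matrix.exists_orthogonal_row_eq M.j0 (M.Rhalf k j) hr
  have hmul : Measurable fun v : Fin M.p → ℝ => Q.mulVec v := by
    unfold Matrix.mulVec dotProduct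
    fun_prop
  have hu := M.hmu k i
  have hξ := M.hmξ k i
  have hrot : IdentDistrib (fun ω => Q.mulVec (M.u k i ω)) (M.u k i) M.μ M.μ :=
    ⟨(hmul.comp hu).aemeasurable, hu.aemeasurable, M.hrot k i Q hQ⟩
  have hpair := (IdentDistrib.refl hξ.aemeasurable).prodMk hrot
    ((M.hξu k i).comp measurable_id hmul) (M.hξu k i)
  have hfinal := (hpair.trans (M.hident k i l)).comp
    (u := fun z : ℝ × (Fin M.p → ℝ) => z.1 * z.2 M.j0) (by fun_prop)
  have hfun : M.standardized k j i
      = (fun z => z.1 * z.2 M.j0) ∘ fun ω => (M.ξ k i ω, Q.mulVec (M.u k i ω)) := by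
    funext ω
    rw [M.standardized_eq, ← hQrow]
    rfl
  rw [hfun]
  exact hfinal

theorem Z_indepFun (k : Fin 2) : IndepFun (M.Z k (M.o0 k)) (M.Z k (M.o1 k)) M.μ := by
  have hne : (⟨k, M.o0 k⟩ : (k : Fin 2) × Fin (M.n k)) ≠ ⟨k, M.o1 k⟩ := fun h => by
    simpa [o0, o1] using sigma_mk_injective h
  exact (M.hindep.indepFun hne).comp
    (φ := fun z : ℝ × (Fin M.p → ℝ) => z.1 * z.2 M.j0)
    (ψ := fun z : ℝ × (Fin M.p → ℝ) => z.1 * z.2 M.j0) (by fun_prop) (by fun_prop)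

theorem integral_pairKernel (k : Fin 2) (j : Fin M.p) (t : ℝ) {i l : Fin (M.n k)} (hil : i ≠ l) :
    ∫ ω, (if |M.standardized k j i ω - M.standardized k j l ω| ≤ t then (1 : ℝ) else 0) ∂M.μ
      = M.Fdelta k t := by
  have := M.hμ
  have hset : MeasurableSet {z : ℝ × ℝ | |z.1 - z.2| ≤ t} :=
    measurableSet_le (by fun_prop) (by fun_prop)
  have hpair := (M.identDistrib_standardized k j i (M.o0 k)).prodMk
    (M.identDistrib_standardized k j l (M.o1 k))
    ((M.iIndepFun_standardized k j).indepFun hil) (M.Z_indepFun k)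
  have hmem := hpair.measure_mem_eq hset
  have hmeas : MeasurableSet
      {ω | |M.standardized k j i ω - M.standardized k j l ω| ≤ t} :=
    ((M.measurable_standardized k j i).prodMk (M.measurable_standardized k j l)) hset
  have hind : (fun ω => if |M.standardized k j i ω - M.standardized k j l ω| ≤ t then (1 : ℝ)
      else 0) = {ω | |M.standardized k j i ω - M.standardized k j l ω| ≤ t}.indicator 1 := by
    funext ω
    simp [Set.indicator_apply]
  rw [hind, integral_indicator_one hmeas]
  exact congrArg ENNReal.toReal hmem

theorem Fhat_sqrt_mul (k : Fin 2) (j : Fin M.p) (t : ℝ) (ω : Ω) :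
    M.Fhat k j (Real.sqrt (M.d0 k j) * t) ω = ((M.n k).choose 2 : ℝ)⁻¹ *
      ∑ i, ∑ l, if i < l then (if |M.standardized k j i ω - M.standardized k j l ω| ≤ t
        then (1 : ℝ) else 0) else 0 := by
  have hd : 0 < Real.sqrt (M.d0 k j) := Real.sqrt_pos.mpr (M.hd0 k j)
  have hdiff : ∀ i l, |M.X k i ω j - M.X k l ω j|
      = Real.sqrt (M.d0 k j) * |M.standardized k j i ω - M.standardized k j l ω| := by
    intro i l
    conv_rhs => rw [← abs_of_pos hd, ← abs_mul]
    congr 1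
    simp only [X, standardized]
    ring
  simp_rw [Fhat, hdiff, mul_le_mul_iff_right₀ hd]

theorem hasSubgaussianMGF_Fhat (k : Fin 2) (j : Fin M.p) (t : ℝ) :
    HasSubgaussianMGF (fun ω => M.Fhat k j (Real.sqrt (M.d0 k j) * t) ω - M.Fdelta k t)
      (4 * (M.n k / 2 : ℕ))⁻¹ M.μ := by
  have := M.hμ
  simp_rw [Fhat_sqrt_mul]
  refine (M.iIndepFun_standardized k j).hasSubgaussianMGF_pair_average (M.hn k)
    (M.measurable_standardized k j)
    (H := fun z => if |z.1 - z.2| ≤ t then (1 : ℝ) else 0) ?_ ?_ ?_ ?_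
  · exact Measurable.ite (measurableSet_le (by fun_prop) (by fun_prop)) measurable_const
      measurable_const
  · intro z
    split_ifs <;> simp
  · intro x y
    simp only [abs_sub_comm]
  · exact fun i l hil => M.integral_pairKernel k j t hil

theorem measureReal_Fhat_ge_le (k : Fin 2) (j : Fin M.p) (t : ℝ) {s : ℝ} (hs : 0 ≤ s) :
    M.μ.real {ω | s ≤ M.Fhat k j (Real.sqrt (M.d0 k j) * t) ω - M.Fdelta k t}
      ≤ Real.exp (-(2 * (M.n k / 2 : ℕ) * s ^ 2)) := by
  refine ((M.hasSubgaussianMGF_Fhat k j t).measure_ge_le hs).trans_eq ?_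
  congr 1
  push_cast
  field_simp
  norm_num

theorem measureReal_Fhat_le_le (k : Fin 2) (j : Fin M.p) (t : ℝ) {s : ℝ} (hs : 0 ≤ s) :
    M.μ.real {ω | s ≤ M.Fdelta k t - M.Fhat k j (Real.sqrt (M.d0 k j) * t) ω}
      ≤ Real.exp (-(2 * (M.n k / 2 : ℕ) * s ^ 2)) := by
  have h := (M.hasSubgaussianMGF_Fhat k j t).neg.measure_ge_le hs
  simp only [Pi.neg_apply, neg_sub] at h
  refine h.trans_eq ?_
  congr 1
  push_cast
  field_simp
  norm_num

theorem Fdelta_mono (k : Fin 2) : Monotone (M.Fdelta k) := by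
  have := M.hμ
  intro s t hst
  exact ENNReal.toReal_mono (measure_ne_top _ _) (measure_mono fun ω hω => le_trans hω hst)

theorem Fhat_mono (k : Fin 2) (j : Fin M.p) (ω : Ω) : Monotone fun t => M.Fhat k j t ω := by
  intro s t hst
  unfold Fhat
  dsimp only
  gcongr with i _ l _
  split_ifs with h1 h2 h3 h3
  · exact le_rfl
  · exact absurd (h2.trans hst) h3
  · exact zero_le_one
  · exact le_rfl
  · exact le_rfl

variable {M}

theorem le_Fdelta_of_qA_lt {α t : ℝ} {k : Fin 2} (hq : 0 < M.qA α k) (ht : M.qA α k < t) :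
    α ≤ M.Fdelta k t := by
  have hne : {t : ℝ | 0 ≤ t ∧ α ≤ M.Fdelta k t}.Nonempty := by
    by_contra h
    rw [Set.not_nonempty_iff_eq_empty] at h
    simp [qA, h] at hq
  obtain ⟨s, hs, hst⟩ := exists_lt_of_csInf_lt hne ht
  exact hs.2.trans (M.Fdelta_mono k hst.le)

theorem Fdelta_lt_of_lt_qA {α t : ℝ} {k : Fin 2} (h0 : 0 ≤ t) (ht : t < M.qA α k) :
    M.Fdelta k t < α := by
  by_contra! h
  exact notMem_of_lt_csInf ht ⟨0, fun s hs => hs.1⟩ ⟨h0, h⟩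

theorem abs_dhat_div_dT_sub_one_le {α δ : ℝ} {k : Fin 2} {j : Fin M.p} {ω : Ω}
    (hδ : 0 ≤ δ) (hq : 0 < M.qA α k) (hδq : δ ≤ M.qA α k)
    (hlo : M.Fhat k j (Real.sqrt (M.d0 k j) * (M.qA α k - δ)) ω < α)
    (hhi : α ≤ M.Fhat k j (Real.sqrt (M.d0 k j) * (M.qA α k + δ)) ω) :
    |M.dhat α k j ω / M.dT α k j - 1| ≤ 3 * δ / M.qA α k := by
  set q := M.qA α k with hqdef
  set r := Real.sqrt (M.d0 k j) with hr
  have hd : 0 < r := Real.sqrt_pos.mpr (M.hd0 k j)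
  have hmem : r * (q + δ) ∈ {t : ℝ | 0 ≤ t ∧ α ≤ M.Fhat k j t ω} := ⟨by positivity, hhi⟩
  have hub : M.qhat α k j ω ≤ r * (q + δ) := csInf_le ⟨0, fun s hs => hs.1⟩ hmem
  have hlb : r * (q - δ) ≤ M.qhat α k j ω := by
    refine le_csInf ⟨_, hmem⟩ fun s hs => ?_
    by_contra! h
    exact absurd (hs.2.trans (M.Fhat_mono k j ω h.le)) hlo.not_ge
  obtain ⟨v, hv⟩ : ∃ v, M.qhat α k j ω = r * v := ⟨M.qhat α k j ω / r, by field_simp⟩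
  rw [hv] at hub hlb
  have hv1 : v ≤ q + δ := le_of_mul_le_mul_left hub hd
  have hv2 : q - δ ≤ v := le_of_mul_le_mul_left hlb hd
  have hratio : M.dhat α k j ω / M.dT α k j - 1 = (v - q) * (v + q) / q ^ 2 := by
    rw [dhat, dT, hv, ← hqdef, ← Real.sq_sqrt (M.hd0 k j).le, ← hr]
    field_simp
    ring
  rw [hratio, abs_div, abs_mul, abs_of_pos (by positivity : (0 : ℝ) < q ^ 2),
    div_le_div_iff₀ (by positivity) hq]
  have h1 : |v - q| ≤ δ := abs_le.mpr ⟨by linarith, by linarith⟩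
  have h2 : |v + q| ≤ 3 * q := abs_le.mpr ⟨by linarith, by linarith⟩
  calc |v - q| * |v + q| * q ≤ δ * (3 * q) * q := by gcongr
    _ = 3 * δ * q ^ 2 := by ring

theorem thirty_two_le_eight_mul (M : Model Ω) : (32 : ℝ) ≤ 8 * M.p * M.NN := by
  have h : 4 ≤ M.p * M.NN := by
    have h0 := M.hn 0
    have h1 := M.hn 1
    have hp := M.hp
    have hN : 4 ≤ M.NN := by
      unfold NN
      omega
    nlinarith
  have h' : (4 : ℝ) ≤ M.p * M.NN := by exact_mod_cast h
  linarith

theorem one_le_xN (M : Model Ω) : 1 ≤ M.xN := by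
  rw [xN, Real.le_log_iff_exp_le (by linarith [M.thirty_two_le_eight_mul])]
  linarith [M.thirty_two_le_eight_mul, Real.exp_one_lt_d9]

theorem n0_pos (M : Model Ω) : (0 : ℝ) < M.n0 := by
  have h0 := M.hn 0
  have h1 := M.hn 1
  have : 0 < M.n0 := by
    unfold n0
    omega
  exact_mod_cast this

theorem n0_le_three_mul_half (M : Model Ω) (k : Fin 2) :
    (M.n0 : ℝ) ≤ 3 * (M.n k / 2 : ℕ) := by
  have hk := M.hn k
  have h : M.n0 ≤ M.n k := by
    unfold n0
    fin_cases k <;> simp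
  have : M.n0 ≤ 3 * (M.n k / 2) := by omega
  exact_mod_cast this

theorem exp_neg_half_mul_sq_le (M : Model Ω) {c : ℝ} (hc : 0 < c) (k : Fin 2) :
    Real.exp (-(2 * (M.n k / 2 : ℕ) * (c * (2 / c * M.rD)) ^ 2)) ≤ (8 * M.p * M.NN : ℝ)⁻¹ := by
  have hpos : (0 : ℝ) < 8 * M.p * M.NN := by linarith [M.thirty_two_le_eight_mul]
  have hx := M.one_le_xN
  have hn := M.n0_pos
  have hrD : M.rD ^ 2 = M.xN / M.n0 := Real.sq_sqrt (by positivity)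
  have hsq : (c * (2 / c * M.rD)) ^ 2 = 4 * (M.xN / M.n0) := by
    rw [← hrD]
    field_simp
    ring
  rw [← Real.exp_log hpos, ← Real.exp_neg, Real.exp_le_exp, neg_le_neg_iff, hsq]
  change M.xN ≤ _
  have hratio : 1 ≤ 3 * (M.n k / 2 : ℕ) / (M.n0 : ℝ) := by
    rw [one_le_div hn]
    exact M.n0_le_three_mul_half k
  calc M.xN = 1 * M.xN := (one_mul _).symm
    _ ≤ 3 * (M.n k / 2 : ℕ) / (M.n0 : ℝ) * M.xN := by gcongr
    _ ≤ 8 / 3 * (3 * (M.n k / 2 : ℕ) / (M.n0 : ℝ) * M.xN) :=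
        le_mul_of_one_le_left (by positivity) (by norm_num)
    _ = 2 * (M.n k / 2 : ℕ) * (4 * (M.xN / M.n0)) := by ring

theorem measureReal_iSup_dhat_gt_le (M : Model Ω) {α qlo c εF : ℝ} (hqlo : 0 < qlo) (hc : 0 < c)
    (hq : ∀ k, qlo ≤ M.qA α k) (hδq : 2 / c * M.rD ≤ qlo)
    (hF : ∀ k t, |t - M.qA α k| ≤ εF → c * |t - M.qA α k| ≤ |M.Fdelta k t - α|)
    (hδε : 2 / c * M.rD ≤ εF) :
    M.μ.real {ω | 3 * (2 / c) / qlo * M.rD <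
      ⨆ k : Fin 2, ⨆ j : Fin M.p, |M.dhat α k j ω / M.dT α k j - 1|} ≤ M.xN / M.n0 := by
  have := M.hμ
  have hx := M.one_le_xN
  have hn := M.n0_pos
  have hrD : 0 < M.rD := Real.sqrt_pos.mpr (by positivity)
  set δ := 2 / c * M.rD with hδdef
  have hδ : 0 < δ := by positivity
  have hhi : ∀ k, c * δ ≤ M.Fdelta k (M.qA α k + δ) - α := by
    intro k
    have h := hF k (M.qA α k + δ) (by simpa [abs_of_pos hδ] using hδε)
    have h' := le_Fdelta_of_qA_lt (hqlo.trans_le (hq k)) (lt_add_of_pos_right (M.qA α k) hδ)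
    rwa [add_sub_cancel_left, abs_of_pos hδ, abs_of_nonneg (sub_nonneg.mpr h')] at h
  have hlo : ∀ k, c * δ ≤ α - M.Fdelta k (M.qA α k - δ) := by
    intro k
    have h := hF k (M.qA α k - δ) (by simpa [abs_of_pos hδ] using hδε)
    have h' := Fdelta_lt_of_lt_qA (by linarith [hq k]) (sub_lt_self (M.qA α k) hδ)
    rwa [sub_sub_cancel_left, abs_neg, abs_of_pos hδ, abs_of_neg (sub_neg.mpr h'), neg_sub] at h
  let A : Fin 2 → Fin M.p → Set Ω := fun k j => {ω | c * δ ≤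
    M.Fhat k j (Real.sqrt (M.d0 k j) * (M.qA α k - δ)) ω - M.Fdelta k (M.qA α k - δ)}
  let B : Fin 2 → Fin M.p → Set Ω := fun k j => {ω | c * δ ≤
    M.Fdelta k (M.qA α k + δ) - M.Fhat k j (Real.sqrt (M.d0 k j) * (M.qA α k + δ)) ω}
  have hsub : {ω | 3 * (2 / c) / qlo * M.rD <
      ⨆ k : Fin 2, ⨆ j : Fin M.p, |M.dhat α k j ω / M.dT α k j - 1|}
      ⊆ ⋃ k, ⋃ j, (A k j ∪ B k j) := by
    intro ω hω
    by_contra hnot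
    simp only [Set.mem_iUnion, Set.mem_union, not_exists, not_or] at hnot
    rw [Set.mem_ofPred_eq] at hω
    refine absurd hω (not_lt.mpr ?_)
    have : Nonempty (Fin M.p) := ⟨M.j0⟩
    refine ciSup_le fun k => ciSup_le fun j => ?_
    obtain ⟨hA, hB⟩ := hnot k j
    simp only [A, B, Set.mem_ofPred_eq, not_le] at hA hB
    refine (abs_dhat_div_dT_sub_one_le hδ.le (hqlo.trans_le (hq k)) (hδq.trans (hq k))
      (by linarith [hlo k]) (by linarith [hhi k])).trans ?_
    calc 3 * δ / M.qA α k ≤ 3 * δ / qlo := by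
          gcongr
          exact hq k
      _ = 3 * (2 / c) / qlo * M.rD := by
          rw [hδdef]
          ring
  have hAB : ∀ k j, M.μ.real (A k j ∪ B k j) ≤ 2 * (8 * M.p * M.NN : ℝ)⁻¹ := by
    intro k j
    have hcδ : 0 ≤ c * δ := by positivity
    have hA := (M.measureReal_Fhat_ge_le k j (M.qA α k - δ) hcδ).trans
      (M.exp_neg_half_mul_sq_le hc k)
    have hB := (M.measureReal_Fhat_le_le k j (M.qA α k + δ) hcδ).trans
      (M.exp_neg_half_mul_sq_le hc k)
    rw [two_mul]
    exact (measureReal_union_le _ _).trans (add_le_add hA hB)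
  have hp : (0 : ℝ) < M.p := by exact_mod_cast M.hp
  have hN : (M.n0 : ℝ) ≤ M.NN := by
    have : M.n0 ≤ M.NN := by
      unfold n0 NN
      omega
    exact_mod_cast this
  have hNpos : (0 : ℝ) < M.NN := hn.trans_le hN
  calc M.μ.real _ ≤ M.μ.real (⋃ k, ⋃ j, (A k j ∪ B k j)) := measureReal_mono hsub
    _ ≤ ∑ k, M.μ.real (⋃ j, (A k j ∪ B k j)) := measureReal_iUnion_fintype_le _
    _ ≤ ∑ k, ∑ j, M.μ.real (A k j ∪ B k j) :=
        Finset.sum_le_sum fun k _ => measureReal_iUnion_fintype_le _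
    _ ≤ ∑ _k : Fin 2, ∑ _j : Fin M.p, 2 * (8 * M.p * M.NN : ℝ)⁻¹ :=
        Finset.sum_le_sum fun k _ => Finset.sum_le_sum fun j _ => hAB k j
    _ = 1 / 2 * (M.NN : ℝ)⁻¹ := by
        simp only [Finset.sum_const, Finset.card_univ, Fintype.card_fin, nsmul_eq_mul]
        field_simp
        norm_num
    _ ≤ 1 * (M.n0 : ℝ)⁻¹ := by
        gcongr
        norm_num
    _ ≤ M.xN * (M.n0 : ℝ)⁻¹ := by gcongr
    _ = M.xN / M.n0 := (div_eq_mul_inv _ _).symm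

end PDQ.Model

namespace PDQ

/-- uniform consistency rate of the pairwise-difference quantile scale
estimators.  Under the null hypothesis `θ_1 = θ_2` and Assumptions (A1)–(A3),
`max_{k} max_{j} |d̂_{kj}/d_{kj} − 1| = O_p(r_D)`:  for every `ε > 0` there exists
`C < ∞` with `limsup_ν P( max_{k,j} |d̂_{kj}/d_{kj} − 1| > C r_D ) < ε`. -/
theorem dhat_uniform_rate
    {Ω : Type} [MeasurableSpace Ω] (α : ℝ) (hα : 0 < α ∧ α < 1)
    (Ms : ℕ → Model Ω)
    (hH0 : ∀ ν, (Ms ν).H0)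
    (hA1 : A1 Ms) (hA2 : A2 Ms) (hA3 : A3 α Ms) :
    ∀ ε : ℝ, 0 < ε → ∃ C : ℝ,
      Filter.limsup (fun ν =>
          ((Ms ν).μ {ω | C * (Ms ν).rD <
            ⨆ k : Fin 2, ⨆ j : Fin (Ms ν).p,
              |(Ms ν).dhat α k j ω / (Ms ν).dT α k j - 1|}).toReal)
        Filter.atTop < ε := by
  intro ε hε
  obtain ⟨qlo, qhi, c, CF, εF, hqlo, -, hc, hεF, hA3⟩ := hA3
  refine ⟨3 * (2 / c) / qlo, ?_⟩
  have hrD : Tendsto (fun ν => 2 / c * (Ms ν).rD) atTop (nhds 0) := by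
    have h := ((Real.continuous_sqrt.tendsto 0).comp hA1.2).const_mul (2 / c)
    rwa [Real.sqrt_zero, mul_zero] at h
  have hsmall : ∀ᶠ ν in atTop, 2 / c * (Ms ν).rD < min εF qlo :=
    hrD.eventually_lt_const (lt_min hεF hqlo)
  have htend : Tendsto (fun ν => ((Ms ν).μ {ω | 3 * (2 / c) / qlo * (Ms ν).rD <
      ⨆ k : Fin 2, ⨆ j : Fin (Ms ν).p,
        |(Ms ν).dhat α k j ω / (Ms ν).dT α k j - 1|}).toReal) atTop (nhds 0) := by
    refine squeeze_zero' (Eventually.of_forall fun ν => ENNReal.toReal_nonneg) ?_ hA1.2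
    filter_upwards [hsmall] with ν hν
    exact (Ms ν).measureReal_iSup_dhat_gt_le hqlo hc
      (fun k => (hA3 ν k).1.1) (hν.le.trans (min_le_right _ _))
      (fun k t ht => ((hA3 ν k).2 t ht).1) (hν.le.trans (min_le_left _ _))
  rw [htend.limsup_eq]
  exact hε

end PDQ

end
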